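/- arXiv:2507.00863 — 6 statements merged into one kernel-verified Lean document; each statement's English description precedes it below -/
import Mathlib

section
/- Let $M$ be a real $n\times n$ matrix all of whose complex eigenvalues have modulus strictly less than $1$ (i.e., $M$ is Schur). Then there exists a symmetric positive definite real $n\times n$ matrix $\Psi$ such that $\Psi - M^\top \Psi M$ is positive definite, i.e., $M^\top \Psi M - \Psi \prec 0$. -/
open Matrix

open scoped Matrix.Norms.L2Operator in
/-- Some positive power of a complex Schur matrix is a strict contraction. -/
lemma exists_pow_norm_lt_one_of_spectrum {n : ℕ} (A : Matrix (Fin n) (Fin n) ℂ)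
    (hA : ∀ μ ∈ spectrum ℂ A, ‖μ‖ < 1) : ∃ N : ℕ, 0 < N ∧ ‖A ^ N‖ < 1 := by
  rcases isEmpty_or_nonempty (Fin n) with hn | hn
  · exact ⟨1, one_pos, by rw [Subsingleton.elim (A ^ 1) 0, norm_zero]; exact one_pos⟩
  have hr : spectralRadius ℂ A < 1 := by
    simpa using spectrum.spectralRadius_lt_of_forall_lt A (r := 1) fun μ hμ => hA μ hμ
  have hlim := spectrum.pow_nnnorm_pow_one_div_tendsto_nhds_spectralRadius A
  obtain ⟨N, hN, hN0⟩ :=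
    ((hlim.eventually_lt_const hr).and (Filter.eventually_gt_atTop 0)).exists
  refine ⟨N, hN0, ?_⟩
  by_contra! h
  refine hN.not_ge (ENNReal.one_le_rpow ?_ (by positivity))
  exact_mod_cast h

open scoped Matrix.Norms.L2Operator in
/-- If the complexification of `A` is a strict contraction, then `1 - Aᵀ A` is positive definite. -/
lemma posDef_one_sub_transpose_mul_self {n : ℕ} (A : Matrix (Fin n) (Fin n) ℝ)
    (hA : ‖A.map (algebraMap ℝ ℂ)‖ < 1) : (1 - Aᵀ * A).PosDef := by
  refine PosDef.of_dotProduct_mulVec_pos ?_ fun x hx => ?_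
  · simp [IsHermitian, conjTranspose_eq_transpose_of_trivial]
  have hnorm (y : Fin n → ℝ) :
      ‖WithLp.toLp 2 (fun i => (y i : ℂ))‖ ^ 2 = y ⬝ᵥ y := by
    rw [EuclideanSpace.norm_sq_eq]
    simp [dotProduct, ← sq]
  have hmul : A.map (algebraMap ℝ ℂ) *ᵥ (fun i => (x i : ℂ)) = fun i => ((A *ᵥ x) i : ℂ) := by
    ext i
    simp [mulVec, dotProduct]
  have hpos : 0 < x ⬝ᵥ x := by
    simpa using dotProduct_star_self_pos_iff.mpr hx
  have hle : ‖WithLp.toLp 2 (fun i => ((A *ᵥ x) i : ℂ))‖ ≤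
      ‖A.map (algebraMap ℝ ℂ)‖ * ‖WithLp.toLp 2 (fun i => (x i : ℂ))‖ := by
    rw [← hmul]
    exact l2_opNorm_mulVec (A.map (algebraMap ℝ ℂ)) (WithLp.toLp 2 (fun i => (x i : ℂ)))
  have hx0 : 0 < ‖WithLp.toLp 2 (fun i => (x i : ℂ))‖ := by
    rw [← hnorm] at hpos
    exact (norm_nonneg _).lt_of_ne' (pow_ne_zero_iff two_ne_zero |>.mp hpos.ne')
  have hlt := hle.trans_lt (mul_lt_of_lt_one_left hx0 hA)
  have hsq := pow_lt_pow_left₀ hlt (norm_nonneg _) two_ne_zero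
  rw [hnorm, hnorm] at hsq
  simpa [sub_mulVec, ← mulVec_mulVec, dotProduct_sub, dotProduct_mulVec, vecMul_transpose]
    using hsq

/-- The finite Gramian of `M` satisfies a telescoping Stein identity. -/
lemma gramian_sub_conj {n : ℕ} (M : Matrix (Fin n) (Fin n) ℝ) (N : ℕ) :
    (∑ k ∈ Finset.range N, (M ^ k)ᵀ * M ^ k) -
      Mᵀ * (∑ k ∈ Finset.range N, (M ^ k)ᵀ * M ^ k) * M = 1 - (M ^ N)ᵀ * M ^ N := by
  have h (k : ℕ) : Mᵀ * ((M ^ k)ᵀ * M ^ k) * M = (M ^ (k + 1))ᵀ * M ^ (k + 1) := by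
    rw [pow_succ, transpose_mul]
    simp only [Matrix.mul_assoc]
  rw [Finset.mul_sum, Finset.sum_mul, ← Finset.sum_sub_distrib]
  simp only [h]
  rw [Finset.sum_range_sub' fun k => (M ^ k)ᵀ * M ^ k]
  simp

/-- The finite Gramian of `M` with at least one term is positive definite. -/
lemma posDef_gramian {n : ℕ} (M : Matrix (Fin n) (Fin n) ℝ) {N : ℕ} (hN : 0 < N) :
    (∑ k ∈ Finset.range N, (M ^ k)ᵀ * M ^ k).PosDef := by
  obtain ⟨m, rfl⟩ := Nat.exists_eq_add_of_lt hN
  rw [zero_add, Finset.sum_range_succ']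
  refine PosDef.posSemidef_add (posSemidef_sum _ fun k _ => ?_) ?_
  · simpa [conjTranspose_eq_transpose_of_trivial] using
      posSemidef_conjTranspose_mul_self (M ^ (k + 1))
  · simpa using PosDef.one

/-- Discrete-time Lyapunov theorem (existence direction): if every complex
eigenvalue of the real matrix `M` has modulus `< 1` (i.e. `M` is Schur), then
there exists a symmetric positive definite `Ψ` with `Ψ - Mᵀ Ψ M ≻ 0`. -/
theorem schur_implies_lyapunov {n : ℕ} (M : Matrix (Fin n) (Fin n) ℝ)
    (hSchur : ∀ μ ∈ spectrum ℂ (M.map (algebraMap ℝ ℂ)), ‖μ‖ < 1) :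
    ∃ Ψ : Matrix (Fin n) (Fin n) ℝ, Ψ.PosDef ∧ (Ψ - Mᵀ * Ψ * M).PosDef := by
  obtain ⟨N, hN, hlt⟩ := exists_pow_norm_lt_one_of_spectrum _ hSchur
  refine ⟨_, posDef_gramian M hN, ?_⟩
  rw [gramian_sub_conj]
  apply posDef_one_sub_transpose_mul_self
  rwa [Matrix.map_pow]
end

section
/- Let $M$ be a real $n\times n$ matrix. If there exists a symmetric positive definite real $n\times n$ mat0rix $\Psi$ such that $\Psi - M^\top \Psi M$ is positive definite, then every complex eigenvalue of $M$ has modulus strictly less than $1$ (i.e., $M$ is Schur). -/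
open Matrix

/-- A complex eigenvalue of a real matrix gives a real invariant pair of vectors, the real and
imaginary parts of an eigenvector. -/
lemma Matrix.exists_real_imag_of_mem_spectrum {ι : Type*} [Fintype ι] [DecidableEq ι]
    (M : Matrix ι ι ℝ) {μ : ℂ} (hμ : μ ∈ spectrum ℂ (M.map (algebraMap ℝ ℂ))) :
    ∃ x y : ι → ℝ, (x ≠ 0 ∨ y ≠ 0) ∧
      M *ᵥ x = μ.re • x - μ.im • y ∧ M *ᵥ y = μ.im • x + μ.re • y := by
  rw [← Matrix.spectrum_toLin', ← Module.End.hasEigenvalue_iff_mem_spectrum] at hμ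
  obtain ⟨v, hv⟩ := hμ.exists_hasEigenvector
  have hMv : ∀ i, ∑ j, (M i j : ℂ) * v j = μ * v i := fun i => by
    simpa [Matrix.mulVec, dotProduct] using congrFun hv.apply_eq_smul i
  refine ⟨fun i => (v i).re, fun i => (v i).im, ?_, ?_, ?_⟩
  · by_contra! h
    exact hv.2 (funext fun i => Complex.ext (congrFun h.1 i) (congrFun h.2 i))
  · ext i
    simpa [Matrix.mulVec, dotProduct] using congrArg Complex.re (hMv i)
  · ext i
    simpa [Matrix.mulVec, dotProduct, add_comm] using congrArg Complex.im (hMv i)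

/-- A rotation-scaling of a pair of vectors multiplies the sum of the values of a quadratic form
by the square of the scaling factor. -/
lemma Matrix.dotProduct_mulVec_rotation {ι : Type*} [Fintype ι] (A : Matrix ι ι ℝ)
    (x y : ι → ℝ) (a b : ℝ) :
    (a • x - b • y) ⬝ᵥ (A *ᵥ (a • x - b • y)) + (b • x + a • y) ⬝ᵥ (A *ᵥ (b • x + a • y)) =
      (a ^ 2 + b ^ 2) * (x ⬝ᵥ (A *ᵥ x) + y ⬝ᵥ (A *ᵥ y)) := by
  simp only [mulVec_sub, mulVec_add, mulVec_smul, sub_dotProduct, add_dotProduct, dotProduct_sub,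
    dotProduct_add, smul_dotProduct, dotProduct_smul, smul_eq_mul]
  ring

/-- A positive definite real quadratic form is positive on a pair of vectors that do not both
vanish. -/
lemma Matrix.PosDef.add_dotProduct_mulVec_pos {ι : Type*} [Fintype ι] {A : Matrix ι ι ℝ}
    (hA : A.PosDef) {x y : ι → ℝ} (h : x ≠ 0 ∨ y ≠ 0) :
    0 < x ⬝ᵥ (A *ᵥ x) + y ⬝ᵥ (A *ᵥ y) := by
  have hx : 0 ≤ x ⬝ᵥ (A *ᵥ x) := hA.posSemidef.dotProduct_mulVec_nonneg x
  have hy : 0 ≤ y ⬝ᵥ (A *ᵥ y) := hA.posSemidef.dotProduct_mulVec_nonneg y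
  rcases h with h | h
  · exact add_pos_of_pos_of_nonneg (hA.dotProduct_mulVec_pos h) hy
  · exact add_pos_of_nonneg_of_pos hx (hA.dotProduct_mulVec_pos h)

/-- Discrete-time Lyapunov theorem (converse direction): if there exists a
symmetric positive definite `Ψ` with `Ψ - Mᵀ Ψ M ≻ 0`, then every complex
eigenvalue of `M` has modulus `< 1` (i.e. `M` is Schur). -/
theorem lyapunov_implies_schur {n : ℕ} (M : Matrix (Fin n) (Fin n) ℝ)
    (Ψ : Matrix (Fin n) (Fin n) ℝ) (hΨ : Ψ.PosDef)
    (hLyap : (Ψ - Mᵀ * Ψ * M).PosDef) :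
    ∀ μ ∈ spectrum ℂ (M.map (algebraMap ℝ ℂ)), ‖μ‖ < 1 := by
  intro μ hμ
  obtain ⟨x, y, hxy, hx, hy⟩ := M.exists_real_imag_of_mem_spectrum hμ
  have hpos := hΨ.add_dotProduct_mulVec_pos hxy
  have hdecr := hLyap.add_dotProduct_mulVec_pos hxy
  have hform : ∀ z : Fin n → ℝ, z ⬝ᵥ ((Ψ - Mᵀ * Ψ * M) *ᵥ z) =
      z ⬝ᵥ (Ψ *ᵥ z) - (M *ᵥ z) ⬝ᵥ (Ψ *ᵥ (M *ᵥ z)) := fun z => by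
    rw [sub_mulVec, dotProduct_sub, ← mulVec_mulVec, ← mulVec_mulVec, dotProduct_mulVec z Mᵀ,
      vecMul_transpose]
  rw [hform, hform, hx, hy] at hdecr
  have hrot := Ψ.dotProduct_mulVec_rotation x y μ.re μ.im
  have hsq : ‖μ‖ ^ 2 = μ.re ^ 2 + μ.im ^ 2 := by
    rw [Complex.sq_norm, Complex.normSq_apply]
    ring
  rw [← hsq] at hrot
  by_contra! hge
  nlinarith [mul_le_mul_of_nonneg_right (one_le_pow₀ hge (n := 2)) hpos.le]
end

section
/- Let $A$ be a real $n\times n$ matrix and $B$ a real $n\times p$ matrix. Let $Q_x$ be a symmetric positive definite real $n\times n$ matrix, $Q_u$ a symmetric positive semidefinite real $p\times p$ matrix, and $Q_N$ a symmetric positive definite real $n\times n$ matrix satisfying the discrete algebraic Riccati equation $Q_N = A^\top Q_N A - (A^\top Q_N B)(Q_u + B^\top Q_N B)^{-1}(B^\top Q_N A) + Q_x$, where $Q_u + B^\top Q_N B$ is invertible. Set $K = -(Q_u + B^\top Q_N B)^{-1}(B^\top Q_N A)$. Then the closed-loop matrix $A + BK$ is Schur: every complex eigenvalue of $A + BK$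 has modulus strictly less than $1$. -/
open Matrix

section ComplexOrder

open scoped ComplexOrder

/-- If `Q - Mᴴ Q M` is positive definite for some positive semidefinite `Q`, then all eigenvalues
of `M` lie in the open unit disk. -/
theorem norm_lt_one_of_mem_spectrum_of_posDef_sub {n : Type*} [Fintype n] [DecidableEq n]
    {M Q : Matrix n n ℂ} (hQ : Q.PosSemidef) (hP : (Q - Mᴴ * Q * M).PosDef)
    {μ : ℂ} (hμ : μ ∈ spectrum ℂ M) : ‖μ‖ < 1 := by
  rw [← Matrix.spectrum_toLin', ← Module.End.hasEigenvalue_iff_mem_spectrum] at hμ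
  obtain ⟨v, hv⟩ := hμ.exists_hasEigenvector
  have hMv : M *ᵥ v = μ • v := hv.apply_eq_smul
  have hpos := hP.dotProduct_mulVec_pos hv.2
  have hnonneg := (Complex.le_def.mp (hQ.dotProduct_mulVec_nonneg v)).1
  have hform : star v ⬝ᵥ (Q - Mᴴ * Q * M) *ᵥ v
      = ((1 - ‖μ‖ ^ 2 : ℝ) : ℂ) * (star v ⬝ᵥ Q *ᵥ v) := by
    have : star v ⬝ᵥ (Mᴴ * Q * M) *ᵥ v = star (M *ᵥ v) ⬝ᵥ Q *ᵥ (M *ᵥ v) := by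
      simp only [star_mulVec, ← dotProduct_mulVec, mulVec_mulVec, Matrix.mul_assoc]
    rw [sub_mulVec, dotProduct_sub, this, hMv]
    simp only [star_smul, smul_dotProduct, mulVec_smul, dotProduct_smul, smul_eq_mul]
    rw [Complex.ofReal_sub, Complex.ofReal_pow, ← Complex.conj_mul']
    simp
    ring
  rw [hform, Complex.lt_def, Complex.re_ofReal_mul] at hpos
  have hre := hpos.1
  simp only [Complex.zero_re] at hre hnonneg
  by_contra! hc
  nlinarith [mul_nonneg (show (0 : ℝ) ≤ ‖μ‖ ^ 2 - 1 by nlinarith) hnonneg]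

open scoped MatrixOrder in
/-- A real positive semidefinite matrix is positive semidefinite over `ℂ`. -/
theorem Matrix.PosSemidef.map_algebraMap_complex {n : Type*} [Fintype n] [DecidableEq n]
    {P : Matrix n n ℝ} (hP : P.PosSemidef) : (P.map (algebraMap ℝ ℂ)).PosSemidef := by
  obtain ⟨C, rfl⟩ := CStarAlgebra.nonneg_iff_eq_star_mul_self.mp hP.nonneg
  rw [Matrix.map_mul, star_eq_conjTranspose, conjTranspose_map _ (fun x => by simp)]
  exact posSemidef_conjTranspose_mul_self _

/-- A real positive definite matrix is positive definite over `ℂ`. -/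
theorem Matrix.PosDef.map_algebraMap_complex {n : Type*} [Fintype n] [DecidableEq n]
    {P : Matrix n n ℝ} (hP : P.PosDef) : (P.map (algebraMap ℝ ℂ)).PosDef :=
  hP.posSemidef.map_algebraMap_complex.posDef_iff_isUnit.mpr
    (hP.isUnit.map (algebraMap ℝ ℂ).mapMatrix)

end ComplexOrder

/-- The closed-loop form of the discrete algebraic Riccati equation: the cost matrix `Q`
decreases along the closed-loop dynamics by the stage cost `Qx + Kᵀ Qu K`. -/
theorem riccati_sub_closedLoop {R n p : Type*} [CommRing R] [Fintype n] [Fintype p]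
    [DecidableEq p] {A Qx Q : Matrix n n R} {B : Matrix n p R} {Qu : Matrix p p R}
    {K : Matrix p n R} (hinv : IsUnit (Qu + Bᵀ * Q * B))
    (hRiccati : Q = Aᵀ * Q * A
      - (Aᵀ * Q * B) * (Qu + Bᵀ * Q * B)⁻¹ * (Bᵀ * Q * A) + Qx)
    (hK : K = -((Qu + Bᵀ * Q * B)⁻¹ * (Bᵀ * Q * A))) :
    Q - (A + B * K)ᵀ * Q * (A + B * K) = Qx + Kᵀ * Qu * K := by
  have hSK : (Qu + Bᵀ * Q * B) * K = -(Bᵀ * Q * A) := by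
    rw [hK, Matrix.mul_neg, mul_nonsing_inv_cancel_left _ _ ((isUnit_iff_isUnit_det _).mp hinv)]
  have hQx : Q = Aᵀ * Q * A + Aᵀ * Q * B * K + Qx := by
    rw [hK, Matrix.mul_neg, ← sub_eq_add_neg, ← Matrix.mul_assoc]
    exact hRiccati
  have hKSK : Kᵀ * Qu * K + Kᵀ * Bᵀ * Q * B * K = -(Kᵀ * Bᵀ * Q * A) := by
    simpa only [Matrix.mul_add, Matrix.add_mul, Matrix.mul_neg, Matrix.mul_assoc]
      using congrArg (Kᵀ * ·) hSK
  have hexp : (A + B * K)ᵀ * Q * (A + B * K) = Aᵀ * Q * A + Aᵀ * Q * B * K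
      + (Kᵀ * Bᵀ * Q * A + Kᵀ * Bᵀ * Q * B * K) := by
    simp only [transpose_add, transpose_mul, Matrix.add_mul, Matrix.mul_add, Matrix.mul_assoc]
    abel
  rw [hexp, ← neg_eq_iff_eq_neg.mpr hKSK]
  nth_rw 1 [hQx]
  abel

/-- If `Q_x ≻ 0`, `Q_u ⪰ 0`, and `Q_N ≻ 0` solves the discrete algebraic
Riccati equation with `Q_u + Bᵀ Q_N B` invertible, then the closed-loop matrix
`A + BK` with `K = -(Q_u + Bᵀ Q_N B)⁻¹ (Bᵀ Q_N A)` is Schur: every complex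
eigenvalue has modulus `< 1`. -/
theorem riccati_closed_loop_schur {n p : ℕ}
    (A : Matrix (Fin n) (Fin n) ℝ) (B : Matrix (Fin n) (Fin p) ℝ)
    (Qx QN : Matrix (Fin n) (Fin n) ℝ) (Qu : Matrix (Fin p) (Fin p) ℝ)
    (hQx : Qx.PosDef) (hQu : Qu.PosSemidef) (hQN : QN.PosDef)
    (hinv : IsUnit (Qu + Bᵀ * QN * B))
    (hRiccati : QN = Aᵀ * QN * A
      - (Aᵀ * QN * B) * (Qu + Bᵀ * QN * B)⁻¹ * (Bᵀ * QN * A) + Qx)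
    (K : Matrix (Fin p) (Fin n) ℝ)
    (hK : K = -((Qu + Bᵀ * QN * B)⁻¹ * (Bᵀ * QN * A))) :
    ∀ μ ∈ spectrum ℂ ((A + B * K).map (algebraMap ℝ ℂ)), ‖μ‖ < 1 := by
  intro μ hμ
  have hP : (Qx + Kᵀ * Qu * K).PosDef :=
    hQx.add_posSemidef (by simpa using hQu.conjTranspose_mul_mul_same K)
  rw [← riccati_sub_closedLoop hinv hRiccati hK] at hP
  refine norm_lt_one_of_mem_spectrum_of_posDef_sub hQN.posSemidef.map_algebraMap_complex ?_ hμ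
  convert hP.map_algebraMap_complex using 1
  rw [← conjTranspose_map _ (fun x => by simp), conjTranspose_eq_transpose_of_trivial,
    ← Matrix.map_mul, ← Matrix.map_mul, ← Matrix.map_sub _ (by simp)]
end

section
/- Let $A, B, Q_x, Q_u, Q_N, K$ be as follows: $Q_x$ symmetric positive definite $n\times n$, $Q_u$ symmetric positive semidefinite $p\times p$, $Q_N$ symmetric positive definite $n\times n$ satisfying the discrete algebraic Riccati equation $Q_N = A^\top Q_N A - (A^\top Q_N B)(Q_u + B^\top Q_N B)^{-1}(B^\top Q_N A) + Q_x$ with $Q_u + B^\top Q_N B$ invertible, and $K = -(Q_u + B^\top Q_N B)^{-1}(B^\top Q_N A)$. Let $\bar{x} \in \mathbb{R}^n$, $\bar{u} \in \mathbb{R}^p$ satisfy $\bar{x} = A\bar{x} + B\bar{u}$, and let $x(0) \in \mathbb{R}^n$. Define the closed-loop trajectory $x(s+1) = A x(s) + B u(s)$ with $u(s) = \bar{u} + K(x(s) - \bar{x})$. Then the infinite-horizon cost series converges and $\sum_{s=0}^{\infty} \big( (x(s)-\bar{x})^\top Q_x (x(s)-\bar{x}) + (u(s)-\bar{u})^\top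 Q_u (u(s)-\bar{u}) \big) = (x(0)-\bar{x})^\top Q_N (x(0)-\bar{x})$. (This is the sense in which the Riccati-based terminal cost is optimal for the unconstrained problem.) -/
open Matrix

open scoped MatrixOrder Matrix.Norms.L2Operator in
/-- If the quadratic form of a positive definite matrix tends to zero along a family of vectors,
the family itself tends to zero. -/
theorem Matrix.PosDef.tendsto_zero_of_dotProduct_mulVec {ι m : Type*} [Fintype m] [DecidableEq m]
    {l : Filter ι} {Q : Matrix m m ℝ} (hQ : Q.PosDef) {e : ι → m → ℝ}
    (h : Filter.Tendsto (fun i => e i ⬝ᵥ Q.mulVec (e i)) l (nhds 0)) :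
    Filter.Tendsto e l (nhds 0) := by
  obtain ⟨S, hS, rfl⟩ : ∃ S : Matrix m m ℝ, IsUnit S ∧ Q = Sᵀ * S := by
    obtain ⟨S, hS, h⟩ := CStarAlgebra.isStrictlyPositive_iff_eq_star_mul_self.mp
      hQ.isStrictlyPositive
    exact ⟨S, hS, by simpa [star_eq_conjTranspose, conjTranspose_eq_transpose_of_trivial] using h⟩
  have hsq : ∀ i, e i ⬝ᵥ (Sᵀ * S).mulVec (e i) = ∑ j, S.mulVec (e i) j ^ 2 := fun i => by
    rw [← mulVec_mulVec, dotProduct_mulVec, vecMul_transpose, dotProduct]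
    simp only [pow_two]
  have hSe : Filter.Tendsto (fun i => S.mulVec (e i)) l (nhds 0) := by
    refine tendsto_pi_nhds.mpr fun j => ?_
    have hj : Filter.Tendsto (fun i => S.mulVec (e i) j ^ 2) l (nhds 0) := by
      refine squeeze_zero (fun i => sq_nonneg _) (fun i => ?_) h
      rw [hsq]
      exact Finset.single_le_sum (f := fun j => S.mulVec (e i) j ^ 2)
        (fun k _ => sq_nonneg _) (Finset.mem_univ j)
    have := hj.sqrt
    simp only [Real.sqrt_sq_eq_abs, Real.sqrt_zero] at this
    exact (tendsto_zero_iff_abs_tendsto_zero _).mpr this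
  have hcont : Continuous fun v : m → ℝ => S⁻¹.mulVec v := by fun_prop
  have := (hcont.tendsto 0).comp hSe
  have hdet := (Matrix.isUnit_iff_isUnit_det S).mp hS
  simpa [Function.comp_def, mulVec_mulVec, nonsing_inv_mul S hdet] using this

/-- A solution of the Riccati equation satisfies the closed-loop Lyapunov equation. -/
theorem riccati_lyapunov {m k : Type*} [Fintype m] [Fintype k] [DecidableEq k]
    {A Qx QN : Matrix m m ℝ} {B : Matrix m k ℝ} {Qu : Matrix k k ℝ} {K : Matrix k m ℝ}
    (hinv : IsUnit (Qu + Bᵀ * QN * B))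
    (hRiccati : QN = Aᵀ * QN * A
      - (Aᵀ * QN * B) * (Qu + Bᵀ * QN * B)⁻¹ * (Bᵀ * QN * A) + Qx)
    (hK : K = -((Qu + Bᵀ * QN * B)⁻¹ * (Bᵀ * QN * A))) :
    QN = Qx + Kᵀ * Qu * K + (A + B * K)ᵀ * QN * (A + B * K) := by
  have hMK : Qu * K + Bᵀ * QN * B * K + Bᵀ * QN * A = 0 := by
    rw [← Matrix.add_mul, hK, Matrix.mul_neg,
      mul_nonsing_inv_cancel_left _ _ ((Matrix.isUnit_iff_isUnit_det _).mp hinv)]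
    simp
  have hQN : QN = Aᵀ * QN * A + Aᵀ * QN * B * K + Qx := by
    rw [Matrix.mul_assoc (Aᵀ * QN * B)] at hRiccati
    rw [hK, Matrix.mul_neg, ← sub_eq_add_neg]
    exact hRiccati
  calc QN = Aᵀ * QN * A + Aᵀ * QN * B * K + Qx
        + Kᵀ * (Qu * K + Bᵀ * QN * B * K + Bᵀ * QN * A) := by
        rw [hMK, Matrix.mul_zero, add_zero]
        exact hQN
    _ = _ := by
        simp only [transpose_add, transpose_mul, Matrix.add_mul, Matrix.mul_add, Matrix.mul_assoc]
        abel

/-- Under the LQ-optimal terminal control law `u(s) = ū + K(x(s) - x̄)`, with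
`Q_N` solving the discrete algebraic Riccati equation, the infinite-horizon
cost converges and equals the terminal cost `(x(0) - x̄)ᵀ Q_N (x(0) - x̄)`. -/
theorem riccati_terminal_cost_optimal {n p : ℕ}
    (A : Matrix (Fin n) (Fin n) ℝ) (B : Matrix (Fin n) (Fin p) ℝ)
    (Qx QN : Matrix (Fin n) (Fin n) ℝ) (Qu : Matrix (Fin p) (Fin p) ℝ)
    (hQx : Qx.PosDef) (hQu : Qu.PosSemidef) (hQN : QN.PosDef)
    (hinv : IsUnit (Qu + Bᵀ * QN * B))
    (hRiccati : QN = Aᵀ * QN * A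
      - (Aᵀ * QN * B) * (Qu + Bᵀ * QN * B)⁻¹ * (Bᵀ * QN * A) + Qx)
    (K : Matrix (Fin p) (Fin n) ℝ)
    (hK : K = -((Qu + Bᵀ * QN * B)⁻¹ * (Bᵀ * QN * A)))
    (xbar : Fin n → ℝ) (ubar : Fin p → ℝ)
    (hsteady : xbar = A.mulVec xbar + B.mulVec ubar)
    (x : ℕ → (Fin n → ℝ)) (u : ℕ → (Fin p → ℝ))
    (hu : ∀ s, u s = ubar + K.mulVec (x s - xbar))
    (hdyn : ∀ s, x (s + 1) = A.mulVec (x s) + B.mulVec (u s)) :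
    HasSum
      (fun s : ℕ =>
        (x s - xbar) ⬝ᵥ Qx.mulVec (x s - xbar)
          + (u s - ubar) ⬝ᵥ Qu.mulVec (u s - ubar))
      ((x 0 - xbar) ⬝ᵥ QN.mulVec (x 0 - xbar)) := by
  have hstep : ∀ s, x (s + 1) - xbar = (A + B * K).mulVec (x s - xbar) := fun s => by
    rw [hdyn, hu, add_mulVec, ← mulVec_mulVec, mulVec_add, mulVec_sub A]
    linear_combination -hsteady
  have hdecr : ∀ s, (x s - xbar) ⬝ᵥ Qx.mulVec (x s - xbar)
      + (u s - ubar) ⬝ᵥ Qu.mulVec (u s - ubar)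
      = (x s - xbar) ⬝ᵥ QN.mulVec (x s - xbar)
        - (x (s + 1) - xbar) ⬝ᵥ QN.mulVec (x (s + 1) - xbar) := fun s => by
    have hform : ∀ {k : ℕ} (L : Matrix (Fin k) (Fin n) ℝ) (Q : Matrix (Fin k) (Fin k) ℝ)
        (v : Fin n → ℝ), L.mulVec v ⬝ᵥ Q.mulVec (L.mulVec v) = v ⬝ᵥ (Lᵀ * Q * L).mulVec v :=
      fun L Q v => by
        rw [← mulVec_mulVec, ← mulVec_mulVec, dotProduct_mulVec v, vecMul_transpose]
    have hV := congrArg (fun Q => (x s - xbar) ⬝ᵥ Q.mulVec (x s - xbar))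
      (riccati_lyapunov hinv hRiccati hK)
    simp only [add_mulVec _ _ (x s - xbar), dotProduct_add] at hV
    rw [hstep, hu, add_sub_cancel_left, hform, hform]
    linarith
  have hQx0 : ∀ s, 0 ≤ (x s - xbar) ⬝ᵥ Qx.mulVec (x s - xbar) := fun s => by
    simpa using hQx.posSemidef.dotProduct_mulVec_nonneg (x s - xbar)
  have hQu0 : ∀ s, 0 ≤ (u s - ubar) ⬝ᵥ Qu.mulVec (u s - ubar) := fun s => by
    simpa using hQu.dotProduct_mulVec_nonneg (u s - ubar)
  have hQN0 : ∀ s, 0 ≤ (x s - xbar) ⬝ᵥ QN.mulVec (x s - xbar) := fun s => by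
    simpa using hQN.posSemidef.dotProduct_mulVec_nonneg (x s - xbar)
  have hpartial : ∀ N, ∑ s ∈ Finset.range N, ((x s - xbar) ⬝ᵥ Qx.mulVec (x s - xbar)
      + (u s - ubar) ⬝ᵥ Qu.mulVec (u s - ubar))
      = (x 0 - xbar) ⬝ᵥ QN.mulVec (x 0 - xbar)
        - (x N - xbar) ⬝ᵥ QN.mulVec (x N - xbar) := fun N => by
    rw [Finset.sum_congr rfl fun s _ => hdecr s,
      Finset.sum_range_sub' (fun s => (x s - xbar) ⬝ᵥ QN.mulVec (x s - xbar))]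
  have hsummable := summable_of_sum_range_le (fun s => add_nonneg (hQx0 s) (hQu0 s))
    (fun N => (hpartial N).trans_le (sub_le_self _ (hQN0 N)))
  have hlim : Filter.Tendsto (fun s => x s - xbar) Filter.atTop (nhds 0) :=
    hQx.tendsto_zero_of_dotProduct_mulVec <|
      squeeze_zero hQx0 (fun s => le_add_of_nonneg_right (hQu0 s)) hsummable.tendsto_atTop_zero
  have hcont : Continuous fun v : Fin n → ℝ => v ⬝ᵥ QN.mulVec v := by fun_prop
  have hV : Filter.Tendsto (fun s => (x s - xbar) ⬝ᵥ QN.mulVec (x s - xbar))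
      Filter.atTop (nhds 0) := by
    simpa [Function.comp_def] using (hcont.tendsto 0).comp hlim
  rw [hasSum_iff_tendsto_nat_of_nonneg fun s => add_nonneg (hQx0 s) (hQu0 s)]
  simp only [hpartial]
  simpa using hV.const_sub ((x 0 - xbar) ⬝ᵥ QN.mulVec (x 0 - xbar))
end

section
/- Let $M$ be a real $n\times n$ matrix all of whose complex eigenvalues have modulus strictly less than $1$, let $c \in \mathbb{R}^n$, and let $\bar{x} \in \mathbb{R}^n$ satisfy $\bar{x} = M\bar{x} + c$. Define $\tilde{x}(0|x) = x$, $\tilde{x}(\omega+1|x) = M\,\tilde{x}(\omega|x) + c$. Let $I$ be a finite index set with $a_i \in \mathbb{R}^n$, $b_i \in \mathbb{R}$, assume $a_i^\top \bar{x} < b_i$ for every $i \in I$ (strict feasibility of the steady state), and assume the set $\Omega_0 = \{x : a_i^\top x \leq b_i, \forall i \in I\}$ is bounded. Then there exists $\phi^* \in \mathbb{N}$ such that every $x$ satisfying $a_i^\top \tilde{x}(\omega|x) \leq b_i$ for all $i \in I$ and all $\omega \leq \phi^*$ also satisfies $a_i^\top \tilde{x}(\omega|x) \leq b_i$ for all $i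 \in I$ and all $\omega \in \mathbb{N}$. (Finite determination of the maximal output admissible set: the index $\omega^*$ computed by the algorithm is finite.) -/
open Matrix

open Filter Topology in
/-- Powers of an element of a complex Banach algebra whose spectrum lies in the open unit disk
tend to zero in norm. -/
theorem tendsto_norm_pow_zero_of_forall_spectrum_norm_lt_one {A : Type*} [NormedRing A]
    [NormedAlgebra ℂ A] [CompleteSpace A] (a : A) (ha : ∀ z ∈ spectrum ℂ a, ‖z‖ < 1) :
    Tendsto (fun k : ℕ => ‖a ^ k‖) atTop (𝓝 0) := by
  nontriviality A
  have hrad : spectralRadius ℂ a < (1 : NNReal) :=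
    spectrum.spectralRadius_lt_of_forall_lt a fun z hz => by exact_mod_cast ha z hz
  obtain ⟨r, har, hr⟩ := ENNReal.lt_iff_exists_nnreal_btwn.mp hrad
  have hr' : r < 1 := by exact_mod_cast hr
  refine squeeze_zero' (Eventually.of_forall fun k => norm_nonneg _) ?_
    (tendsto_pow_atTop_nhds_zero_of_lt_one r.coe_nonneg (by exact_mod_cast hr'))
  filter_upwards [(spectrum.pow_nnnorm_pow_one_div_tendsto_nhds_spectralRadius a).eventually_lt_const
    har, eventually_gt_atTop 0] with k hk hk0
  have hk0' : (0 : ℝ) < k := by exact_mod_cast hk0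
  rw [one_div, ENNReal.rpow_inv_lt_iff hk0', ENNReal.rpow_natCast] at hk
  exact_mod_cast hk.le

section LinftyOpNorm

attribute [local instance] Matrix.linftyOpNormedRing Matrix.linftyOpNormedAlgebra

open Filter Topology in
/-- Powers of a real Schur matrix eventually map a given ball into a given neighbourhood
of the origin. -/
theorem Matrix.eventually_norm_pow_mulVec_lt_of_schur {n : Type*} [Fintype n] [DecidableEq n]
    (M : Matrix n n ℝ) (hM : ∀ z ∈ spectrum ℂ (M.map (algebraMap ℝ ℂ)), ‖z‖ < 1)
    (R : ℝ) {ε : ℝ} (hε : 0 < ε) :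
    ∀ᶠ k : ℕ in atTop, ∀ v : n → ℝ, ‖v‖ ≤ R → ‖(M ^ k) *ᵥ v‖ < ε := by
  have : CompleteSpace (Matrix n n ℂ) := FiniteDimensional.complete ℂ _
  have hpow : Tendsto (fun k : ℕ => ‖M ^ k‖) atTop (𝓝 0) := by
    refine (tendsto_norm_pow_zero_of_forall_spectrum_norm_lt_one _ hM).congr fun k => ?_
    rw [← Matrix.map_pow]
    simp [Matrix.linfty_opNorm_def]
  have hlim : Tendsto (fun k : ℕ => ‖M ^ k‖ * R) atTop (𝓝 0) := by
    simpa using hpow.mul_const R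
  filter_upwards [hlim.eventually_lt_const hε] with k hk v hv
  calc ‖(M ^ k) *ᵥ v‖ ≤ ‖M ^ k‖ * ‖v‖ := Matrix.linfty_opNorm_mulVec _ _
    _ ≤ ‖M ^ k‖ * R := by gcongr
    _ < ε := hk

end LinftyOpNorm

/-- Explicit form of the trajectories of an affine recursion around a fixed point. -/
theorem Matrix.sub_fixedPoint_eq_pow_mulVec {n R : Type*} [Fintype n] [DecidableEq n]
    [CommRing R] {M : Matrix n n R} {c p : n → R} (hp : p = M *ᵥ p + c) {u : ℕ → n → R}
    (hu : ∀ k, u (k + 1) = M *ᵥ u k + c) (k : ℕ) :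
    u k - p = (M ^ k) *ᵥ (u 0 - p) := by
  induction k with
  | zero => simp
  | succ k ih =>
    rw [pow_succ', ← Matrix.mulVec_mulVec, ← ih, hu, Matrix.mulVec_sub]
    nth_rewrite 1 [hp]
    abel

/-- Finite determination of the maximal output admissible set: if `M` is
Schur, `x̄ = Mx̄ + c` is a strictly feasible steady state, and the constraint
set `Ω₀` is bounded, then there is a finite index `φ*` such that satisfaction
of the constraints along the trajectory up to step `φ*` implies their
satisfaction for all steps. -/
theorem maximal_admissible_set_finitely_determined {n : ℕ}
    (M : Matrix (Fin n) (Fin n) ℝ)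
    (hSchur : ∀ μ ∈ spectrum ℂ (M.map (algebraMap ℝ ℂ)), ‖μ‖ < 1)
    (c xbar : Fin n → ℝ) (hfix : xbar = M.mulVec xbar + c)
    (I : Type) [Finite I] (a : I → (Fin n → ℝ)) (b : I → ℝ)
    (hstrict : ∀ i : I, a i ⬝ᵥ xbar < b i)
    (hbdd : Bornology.IsBounded {x : Fin n → ℝ | ∀ i : I, a i ⬝ᵥ x ≤ b i})
    (traj : ℕ → (Fin n → ℝ) → (Fin n → ℝ))
    (htraj0 : ∀ x, traj 0 x = x)
    (htrajS : ∀ ω x, traj (ω + 1) x = M.mulVec (traj ω x) + c) :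
    ∃ φs : ℕ, ∀ x : Fin n → ℝ,
      (∀ i : I, ∀ ω ≤ φs, a i ⬝ᵥ traj ω x ≤ b i) →
      ∀ ω : ℕ, ∀ i : I, a i ⬝ᵥ traj ω x ≤ b i := by
  have hnhds : {y : Fin n → ℝ | ∀ i, a i ⬝ᵥ y < b i} ∈ nhds xbar := by
    refine Filter.eventually_all.mpr fun i => ?_
    have hcont : Continuous fun y : Fin n → ℝ => a i ⬝ᵥ y := by fun_prop
    exact hcont.continuousAt.eventually_lt_const (hstrict i)
  obtain ⟨ε, hε, hball⟩ := Metric.mem_nhds_iff.mp hnhds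
  obtain ⟨R, hR⟩ := hbdd.subset_closedBall xbar
  obtain ⟨N, hN⟩ := Filter.eventually_atTop.mp
    (M.eventually_norm_pow_mulVec_lt_of_schur hSchur R hε)
  refine ⟨N, fun x hx ω i => ?_⟩
  rcases le_total ω N with hω | hω
  · exact hx i ω hω
  have hx0 : ‖x - xbar‖ ≤ R := by
    rw [← dist_eq_norm]
    exact hR fun j => by simpa only [htraj0] using hx j 0 (Nat.zero_le N)
  refine (hball ?_ i).le
  rw [Metric.mem_ball, dist_eq_norm,
    Matrix.sub_fixedPoint_eq_pow_mulVec (u := fun k => traj k x) hfix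
      (fun k => htrajS k x) ω, htraj0]
  exact hN ω hω _ hx0
end

section
/- Let $\Psi$ be a symmetric positive definite real $n\times n$ matrix, $K$ a real $p\times n$ matrix, $\bar{x} \in \mathbb{R}^n$ and $\bar{u} \in \mathbb{R}^p$. Suppose the box constraints $\underline{x}_i \leq z_i \leq \bar{x}_i$ ($i = 1, \ldots, n$) and $\underline{u}_j \leq w_j \leq \bar{u}_j$ ($j = 1, \ldots, p$) satisfy $\underline{x}_i < \bar{x}_i,\ \underline{x}_i \leq \bar{x}^{(i)} := e_i^\top \bar{x} \leq \bar{x}_i$ and $\underline{u}_j \leq e_j^\top \bar{u} \leq \bar{u}_j$. Define $\Gamma_i^{up} = (e_i^\top \bar{x} - \bar{x}_i)^2 / (e_i^\top \Psi^{-1} e_i)$, $\Gamma_i^{lo} = (e_i^\top \bar{x} - \underline{x}_i)^2 / (e_i^\top \Psi^{-1} e_i)$ for $i$ with $e_i^\top \Psi^{-1} e_i > 0$, and, for indices $j$ with $K^\top e_j \neq 0$, $\Gamma_j^{u,up} = (e_j^\top K \bar{x} + e_j^\top(\bar{u} - K\bar{x}) - \bar{u}_j)^2 / (e_j^\top K \Psi^{-1}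 K^\top e_j)$ and analogously for the lower input bounds. Let $\Gamma$ be any nonnegative number not exceeding all of these $\Gamma$'s. Then every $x$ with $(x - \bar{x})^\top \Psi (x - \bar{x}) \leq \Gamma$ satisfies $\underline{x}_i \leq x_i \leq \bar{x}_i$ for all $i$ and the terminal control input $\kappa(x) = \bar{u} + K(x - \bar{x})$ satisfies $\underline{u}_j \leq \kappa(x)_j \leq \bar{u}_j$ for all $j$. (The Lyapunov-based terminal set is contained in the state constraint set $\mathcal{X}$ and its terminal-control image is contained in the input constraint set $\mathcal{U}$.) -/
open Matrix

/-- Weighted Cauchy–Schwarz inequality for a positive definite matrix and its inverse. -/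
lemma Matrix.PosDef.sq_dotProduct_le {ι : Type*} [Fintype ι] [DecidableEq ι]
    {A : Matrix ι ι ℝ} (hA : A.PosDef) (c v : ι → ℝ) :
    (c ⬝ᵥ v) ^ 2 ≤ (v ⬝ᵥ A *ᵥ v) * (c ⬝ᵥ A⁻¹ *ᵥ c) := by
  have hsymm : Aᵀ = A := by simpa using hA.isHermitian.eq
  have hdet : IsUnit A.det := (Matrix.isUnit_iff_isUnit_det A).mp hA.isUnit
  have hAw : A *ᵥ (A⁻¹ *ᵥ c) = c := by
    rw [mulVec_mulVec, mul_nonsing_inv A hdet, one_mulVec]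
  have hwA : (A⁻¹ *ᵥ c) ⬝ᵥ A *ᵥ v = c ⬝ᵥ v := by
    rw [dotProduct_mulVec, ← mulVec_transpose, hsymm, hAw]
  have hdiscrim := discrim_le_zero (a := c ⬝ᵥ A⁻¹ *ᵥ c) (b := 2 * (c ⬝ᵥ v))
    (c := v ⬝ᵥ A *ᵥ v) fun r => by
      have h := hA.posSemidef.dotProduct_mulVec_nonneg (v + r • (A⁻¹ *ᵥ c))
      simp only [star_trivial, mulVec_add, mulVec_smul, hAw, add_dotProduct, dotProduct_add,
        smul_dotProduct, dotProduct_smul, smul_eq_mul, hwA] at h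
      rw [dotProduct_comm v c, dotProduct_comm (A⁻¹ *ᵥ c) c] at h
      linarith
  rw [discrim] at hdiscrim
  linarith

/-- A linear functional is bounded on an ellipsoid whose level is at most `d ^ 2 / (cᵀ A⁻¹ c)`. -/
lemma Matrix.PosDef.abs_dotProduct_le_of_le_div {ι : Type*} [Fintype ι] [DecidableEq ι]
    {A : Matrix ι ι ℝ} (hA : A.PosDef) {c v : ι → ℝ} {Γ d : ℝ} (hc : c ≠ 0)
    (hv : v ⬝ᵥ A *ᵥ v ≤ Γ) (hΓ : Γ ≤ d ^ 2 / (c ⬝ᵥ A⁻¹ *ᵥ c)) :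
    |c ⬝ᵥ v| ≤ |d| := by
  have hpos : 0 < c ⬝ᵥ A⁻¹ *ᵥ c := by simpa using hA.inv.dotProduct_mulVec_pos hc
  exact sq_le_sq.mp ((hA.sq_dotProduct_le c v).trans ((le_div_iff₀ hpos).mp (hv.trans hΓ)))

/-- Containment of the Lyapunov-based terminal set: if the level `Γ ≥ 0` does
not exceed the levels `Γᵢ` computed from the box constraints on states and
(via the terminal control law `κ(x) = ū + K(x - x̄)`) on inputs, then the
ellipsoid `{x : (x - x̄)ᵀ Ψ (x - x̄) ≤ Γ}` is contained in the state box, and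
its image under `κ` is contained in the input box.  Here `eᵢᵀ Ψ⁻¹ eᵢ` is the
`(i,i)` entry of `Ψ⁻¹` and `eⱼᵀ K Ψ⁻¹ Kᵀ eⱼ` the `(j,j)` entry of
`K Ψ⁻¹ Kᵀ`. -/
theorem lyapunov_terminal_set_in_constraints {n p : ℕ}
    (Ψ : Matrix (Fin n) (Fin n) ℝ) (hΨ : Ψ.PosDef)
    (K : Matrix (Fin p) (Fin n) ℝ)
    (xbar : Fin n → ℝ) (ubar : Fin p → ℝ)
    (lbx ubx : Fin n → ℝ) (lbu ubu : Fin p → ℝ)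
    (hxlt : ∀ i, lbx i < ubx i)
    (hxbar : ∀ i, lbx i ≤ xbar i ∧ xbar i ≤ ubx i)
    (hubar : ∀ j, lbu j ≤ ubar j ∧ ubar j ≤ ubu j)
    (Γ : ℝ) (hΓ : 0 ≤ Γ)
    (hΓxUp : ∀ i, 0 < Ψ⁻¹ i i → Γ ≤ (xbar i - ubx i) ^ 2 / Ψ⁻¹ i i)
    (hΓxLo : ∀ i, 0 < Ψ⁻¹ i i → Γ ≤ (xbar i - lbx i) ^ 2 / Ψ⁻¹ i i)
    (hΓuUp : ∀ j, Kᵀ.mulVec (Pi.single j 1) ≠ 0 →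
      Γ ≤ (K.mulVec xbar j + (ubar - K.mulVec xbar) j - ubu j) ^ 2
            / (K * Ψ⁻¹ * Kᵀ) j j)
    (hΓuLo : ∀ j, Kᵀ.mulVec (Pi.single j 1) ≠ 0 →
      Γ ≤ (K.mulVec xbar j + (ubar - K.mulVec xbar) j - lbu j) ^ 2
            / (K * Ψ⁻¹ * Kᵀ) j j) :
    ∀ x : Fin n → ℝ, (x - xbar) ⬝ᵥ Ψ.mulVec (x - xbar) ≤ Γ →
      (∀ i, lbx i ≤ x i ∧ x i ≤ ubx i) ∧
      (∀ j, lbu j ≤ (ubar + K.mulVec (x - xbar)) j ∧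
            (ubar + K.mulVec (x - xbar)) j ≤ ubu j) := by
  intro x hx
  refine ⟨fun i => ?_, fun j => ?_⟩
  · have hc : (Pi.single i 1 : Fin n → ℝ) ≠ 0 := by simp
    have hdiag : (Pi.single i 1 : Fin n → ℝ) ⬝ᵥ Ψ⁻¹ *ᵥ Pi.single i 1 = Ψ⁻¹ i i := by simp
    have hpos : 0 < Ψ⁻¹ i i := hΨ.inv.diag_pos
    have hup := hΨ.abs_dotProduct_le_of_le_div hc hx (hdiag ▸ hΓxUp i hpos)
    have hlo := hΨ.abs_dotProduct_le_of_le_div hc hx (hdiag ▸ hΓxLo i hpos)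
    rw [single_one_dotProduct, Pi.sub_apply] at hup hlo
    rw [abs_of_nonpos (sub_nonpos.mpr (hxbar i).2)] at hup
    rw [abs_of_nonneg (sub_nonneg.mpr (hxbar i).1)] at hlo
    constructor <;> linarith [(abs_le.mp hup).2, (abs_le.mp hlo).1]
  · have hrow : Kᵀ *ᵥ Pi.single j 1 = K j := by
      ext i
      simp
    have hcenter : (K *ᵥ xbar) j + (ubar - K *ᵥ xbar) j = ubar j := by simp
    have hval : (ubar + K *ᵥ (x - xbar)) j = ubar j + K j ⬝ᵥ (x - xbar) := rfl
    rw [hval]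
    by_cases hK : K j = 0
    · simpa [hK] using hubar j
    · have hdiag : K j ⬝ᵥ Ψ⁻¹ *ᵥ K j = (K * Ψ⁻¹ * Kᵀ) j j := by
        rw [Matrix.mul_assoc]
        rfl
      have hup := hΓuUp j (hrow ▸ hK)
      have hlo := hΓuLo j (hrow ▸ hK)
      rw [hcenter, ← hdiag] at hup hlo
      replace hup := hΨ.abs_dotProduct_le_of_le_div hK hx hup
      replace hlo := hΨ.abs_dotProduct_le_of_le_div hK hx hlo
      rw [abs_of_nonpos (sub_nonpos.mpr (hubar j).2)] at hup
      rw [abs_of_nonneg (sub_nonneg.mpr (hubar j).1)] at hlo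
      constructor <;> linarith [(abs_le.mp hup).2, (abs_le.mp hlo).1]
end
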